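/- For every integer A ≥ 1 and every real number a ≥ 0: (1/(2π)) ∫_{−∞}^{∞} cos(aξ) (1+ξ²)^{−A} dξ = (e^{−a} / (2^A (A−1)!)) · Σ_{k=0}^{A−1} ((A+k−1)! / (k!(A−k−1)!)) · 2^{−k} · a^{A−1−k}. -/

import Mathlib

open Nat

open MeasureTheory Set Filter Topology in
theorem aux_fourier (w : ℝ) :
    (∫ v : ℝ, Complex.exp (↑(-2 * Real.pi * v * w) * Complex.I) • ((Real.exp (-|v|) : ℝ) : ℂ))
      = 2 / (1 + (2 * Real.pi * w) ^ 2) := by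
  set c : ℂ := ((2 * Real.pi * w : ℝ) : ℂ) * Complex.I with hc
  have hre : c.re = 0 := by simp [hc]
  have h1 : ∀ v ∈ Iic (0:ℝ), Complex.exp (↑(-2 * Real.pi * v * w) * Complex.I) •
      ((Real.exp (-|v|) : ℝ) : ℂ) = Complex.exp ((1 - c) * v) := by
    intro v hv
    rw [abs_of_nonpos hv, smul_eq_mul, Complex.ofReal_exp, ← Complex.exp_add, hc]
    congr 1; push_cast; ring
  have h2 : ∀ v ∈ Ioi (0:ℝ), Complex.exp (↑(-2 * Real.pi * v * w) * Complex.I) •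
      ((Real.exp (-|v|) : ℝ) : ℂ) = Complex.exp ((-1 - c) * v) := by
    intro v hv
    rw [abs_of_pos hv, smul_eq_mul, Complex.ofReal_exp, ← Complex.exp_add, hc]
    congr 1; push_cast; ring
  have r1 : 0 < (1 - c).re := by simp [hre]
  have r2 : (-1 - c).re < 0 := by simp [hre]
  rw [← intervalIntegral.integral_Iic_add_Ioi (b := 0)
    ((integrableOn_exp_mul_complex_Iic r1 0).congr_fun (fun v hv => (h1 v hv).symm) measurableSet_Iic)
    ((integrableOn_exp_mul_complex_Ioi r2 0).congr_fun (fun v hv => (h2 v hv).symm) measurableSet_Ioi),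
    setIntegral_congr_fun measurableSet_Iic h1, setIntegral_congr_fun measurableSet_Ioi h2,
    integral_exp_mul_complex_Iic r1, integral_exp_mul_complex_Ioi r2]
  have n1 : 1 - c ≠ 0 := fun h => by rw [h] at r1; simp at r1
  have n2 : -1 - c ≠ 0 := fun h => by rw [h] at r2; simp at r2
  have n3 : (1 + (2 * (Real.pi:ℂ) * w) ^ 2) ≠ 0 := by
    have : (1 + (2 * Real.pi * w) ^ 2) ≠ 0 := by positivity
    exact_mod_cast this
  have hc2 : c ^ 2 = - (2 * (Real.pi:ℂ) * w) ^ 2 := by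
    rw [hc, mul_pow, Complex.I_sq]; push_cast; ring
  simp only [Complex.ofReal_zero, mul_zero, Complex.exp_zero]
  rw [show (1 + (2 * (Real.pi:ℂ) * w) ^ 2) = (1 - c) * (1 + c) by linear_combination hc2] at n3 ⊢
  have n4 : 1 + c ≠ 0 := right_ne_zero_of_mul n3
  rw [show -1 - c = -(1 + c) by ring]
  field_simp
  ring

open MeasureTheory Set Filter Topology FourierTransform in
theorem aux_base (a : ℝ) (ha : 0 ≤ a) :
    ∫ ξ : ℝ, Real.cos (a * ξ) / (1 + ξ ^ 2) = Real.pi * Real.exp (-a) := by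
  let f : ℝ → ℂ := fun v => ((Real.exp (-|v|) : ℝ) : ℂ)
  have hF : 𝓕 f = fun w : ℝ => (((fun x : ℝ => 2 * (1 + x ^ 2)⁻¹) (2 * Real.pi * w) : ℝ) : ℂ) := by
    ext w
    rw [Real.fourier_real_eq_integral_exp_smul, aux_fourier]
    push_cast
    rw [div_eq_mul_inv]
  have hpi : (2 * Real.pi) ≠ 0 := by positivity
  have hFi : Integrable (𝓕 f) := by
    rw [hF]
    exact ((integrable_inv_one_add_sq.const_mul 2).comp_mul_left' hpi).ofReal
  have hfc : Continuous f := by fun_prop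
  have hfi : Integrable f := by
    suffices h : Integrable (fun v : ℝ => Real.exp (-|v|)) from h.ofReal
    rw [← integrableOn_univ, ← Iic_union_Ioi (a := (0:ℝ))]
    refine IntegrableOn.union ?_ ?_
    · refine (integrableOn_exp_mul_Iic one_pos 0).congr_fun (fun v hv => ?_) measurableSet_Iic
      simp [abs_of_nonpos (show v ≤ 0 from hv)]
    · refine (integrableOn_exp_mul_Ioi (a := -1) (by norm_num) 0).congr_fun (fun v hv => ?_) measurableSet_Ioi
      simp [abs_of_pos (show 0 < v from hv)]
  have key := congrFun (hfc.fourierInv_fourier_eq hfi hFi) a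
  rw [Real.fourierInv_eq', hF] at key
  have key2 := congrArg Complex.re key
  have hint : Integrable (fun v : ℝ => Complex.exp ((↑(2 * Real.pi * inner ℝ v a) * Complex.I)) •
      (((fun x : ℝ => 2 * (1 + x ^ 2)⁻¹) (2 * Real.pi * v) : ℝ) : ℂ)) := by
    rw [hF] at hFi
    refine hFi.mono ?_ ?_
    · apply Continuous.aestronglyMeasurable
      have : ∀ v : ℝ, 1 + (2 * Real.pi * v)^2 ≠ 0 := fun v => by positivity
      fun_prop (disch := assumption)
    · refine Eventually.of_forall fun v => ?_
      rw [norm_smul, Complex.norm_exp_ofReal_mul_I, one_mul]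
  have e1 := integral_re hint
  simp only [RCLike.re_to_complex] at e1
  rw [← e1] at key2
  have e2 : ∀ v : ℝ, (Complex.exp ((↑(2 * Real.pi * inner ℝ v a) * Complex.I)) •
      (((fun x : ℝ => 2 * (1 + x ^ 2)⁻¹) (2 * Real.pi * v) : ℝ) : ℂ)).re =
      (fun ξ : ℝ => 2 * (Real.cos (a * ξ) / (1 + ξ ^ 2))) (2 * Real.pi * v) := by
    intro v
    rw [smul_eq_mul, Complex.re_mul_ofReal, Complex.exp_ofReal_mul_I_re]
    simp only [RCLike.inner_apply, conj_trivial]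
    rw [show 2 * Real.pi * (a * v) = a * (2 * Real.pi * v) by ring]
    ring
  rw [integral_congr_ae (Eventually.of_forall e2)] at key2
  rw [Measure.integral_comp_mul_left (fun ξ : ℝ => 2 * (Real.cos (a * ξ) / (1 + ξ ^ 2))) (2 * Real.pi),
    integral_const_mul] at key2
  simp only [f, Complex.ofReal_re, abs_of_nonneg ha, smul_eq_mul] at key2
  rw [abs_of_pos (by positivity)] at key2
  rw [← key2]
  field_simp

open MeasureTheory in
theorem aux_int (n : ℕ) : Integrable (fun ξ : ℝ => ((1 + ξ ^ 2) ^ (n + 1))⁻¹) := by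
  refine integrable_inv_one_add_sq.mono ?_ (Filter.Eventually.of_forall fun ξ => ?_)
  · apply Continuous.aestronglyMeasurable
    have : ∀ v : ℝ, (1 + v^2)^(n+1) ≠ 0 := fun v => by positivity
    fun_prop (disch := assumption)
  · rw [norm_inv, norm_inv, norm_pow]
    have : 1 ≤ ‖1 + ξ ^ 2‖ := by
      rw [Real.norm_of_nonneg (by positivity)]; nlinarith [sq_nonneg ξ]
    gcongr
    exact le_self_pow₀ this (by omega)

open MeasureTheory in
/-- bounded continuous times the kernel -/
theorem aux_int' (n : ℕ) (g : ℝ → ℝ) (hg : Continuous g) (hb : ∀ x, |g x| ≤ 1) :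
    Integrable (fun ξ : ℝ => g ξ / (1 + ξ ^ 2) ^ (n + 1)) := by
  simp_rw [div_eq_mul_inv]
  exact (aux_int n).bdd_mul (c := 1) hg.aestronglyMeasurable (Filter.Eventually.of_forall hb)

open MeasureTheory in
theorem aux_bound (n : ℕ) (ξ : ℝ) : |ξ / (1 + ξ ^ 2) ^ (n + 2)| ≤ ((1 + ξ ^ 2) ^ (n + 1))⁻¹ := by
  rw [abs_div, abs_of_pos (show (0:ℝ) < (1 + ξ ^ 2) ^ (n + 2) by positivity), pow_succ _ (n+1),
    div_le_iff₀ (by positivity)]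
  field_simp
  nlinarith [sq_nonneg (|ξ| - 1), sq_abs ξ, abs_nonneg ξ]

theorem aux_hd (m : ℕ) (ξ : ℝ) : HasDerivAt (fun ξ : ℝ => ((1 + ξ ^ 2) ^ (m + 1))⁻¹)
    (-(2 * (m + 1)) * (ξ / (1 + ξ ^ 2) ^ (m + 2))) ξ := by
  have h := ((((hasDerivAt_id ξ).pow 2).const_add 1).pow (m + 1)).inv
    (by simp only [id, Pi.pow_apply]; positivity)
  refine HasDerivAt.congr_deriv h ?_
  simp
  field_simp
  ring

open MeasureTheory in
theorem aux_deriv (n : ℕ) (a : ℝ) :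
    HasDerivAt (fun a : ℝ => ∫ ξ : ℝ, Real.cos (a * ξ) / (1 + ξ ^ 2) ^ (n + 2))
      (-(a / (2 * (n + 1))) * ∫ ξ : ℝ, Real.cos (a * ξ) / (1 + ξ ^ 2) ^ (n + 1)) a := by
  have hne : ∀ (k : ℕ) (v : ℝ), (1 + v^2)^k ≠ 0 := fun k v => by positivity
  have hmeas : Continuous (fun ξ : ℝ => -(Real.sin (a * ξ)) * (ξ / (1 + ξ ^ 2) ^ (n + 2))) := by
    fun_prop (disch := exact hne _)
  have hle : ∀ (x ξ : ℝ), ‖-(Real.sin (x * ξ)) * (ξ / (1 + ξ ^ 2) ^ (n + 2))‖ ≤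
      ((1 + ξ ^ 2) ^ (n + 1))⁻¹ := by
    intro x ξ
    rw [norm_mul, norm_neg, Real.norm_eq_abs, Real.norm_eq_abs]
    calc _ ≤ 1 * |ξ / (1 + ξ ^ 2) ^ (n + 2)| := by gcongr; exact Real.abs_sin_le_one _
      _ ≤ _ := by rw [one_mul]; exact aux_bound n ξ
  obtain ⟨hi, hd⟩ := hasDerivAt_integral_of_dominated_loc_of_deriv_le (μ := volume)
    (F := fun a ξ : ℝ => Real.cos (a * ξ) / (1 + ξ ^ 2) ^ (n + 2))
    (F' := fun a ξ : ℝ => -(Real.sin (a * ξ)) * (ξ / (1 + ξ ^ 2) ^ (n + 2))) (x₀ := a)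
    (s := Set.univ) (bound := fun ξ => ((1 + ξ ^ 2) ^ (n + 1))⁻¹) Filter.univ_mem
    (Filter.Eventually.of_forall fun x => Continuous.aestronglyMeasurable
      (by fun_prop (disch := exact hne _)))
    (aux_int' (n + 1) _ (by fun_prop) (fun x => Real.abs_cos_le_one _))
    hmeas.aestronglyMeasurable
    (Filter.Eventually.of_forall fun ξ x _ => hle x ξ) (aux_int n)
    (Filter.Eventually.of_forall fun ξ x _ => by
      have := (((hasDerivAt_id x).mul_const ξ).cos).div_const ((1 + ξ ^ 2) ^ (n + 2))
      refine this.congr_deriv ?_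
      simp; ring)
  refine hd.congr_deriv ?_
  have ibp := integral_mul_deriv_eq_deriv_mul_of_integrable
    (u := fun ξ : ℝ => Real.sin (a * ξ)) (u' := fun ξ : ℝ => Real.cos (a * ξ) * a)
    (v := fun ξ : ℝ => ((1 + ξ ^ 2) ^ (n + 1))⁻¹)
    (v' := fun ξ : ℝ => -(2 * (n + 1)) * (ξ / (1 + ξ ^ 2) ^ (n + 2)))
    (fun ξ _ => by simpa using ((hasDerivAt_id ξ).const_mul a).sin) (fun ξ _ => aux_hd n ξ)
    (by
      refine (hi.const_mul (2 * (n + 1))).congr (Filter.Eventually.of_forall fun ξ => ?_)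
      simp only [Pi.mul_apply]; ring)
    (by
      refine ((aux_int' n (fun ξ => Real.cos (a * ξ)) (by fun_prop)
        (fun x => Real.abs_cos_le_one _)).const_mul a).congr (Filter.Eventually.of_forall fun ξ => ?_)
      simp only [Pi.mul_apply]; ring)
    (by
      refine (aux_int' n (fun ξ => Real.sin (a * ξ)) (by fun_prop)
        (fun x => Real.abs_sin_le_one _)).congr (Filter.Eventually.of_forall fun ξ => ?_)
      simp only [Pi.mul_apply]; ring)
  have e1 : (∫ ξ : ℝ, Real.sin (a * ξ) * (-(2 * (n + 1)) * (ξ / (1 + ξ ^ 2) ^ (n + 2)))) =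
      (2 * ((n : ℝ) + 1)) * ∫ ξ : ℝ, -(Real.sin (a * ξ)) * (ξ / (1 + ξ ^ 2) ^ (n + 2)) := by
    rw [← integral_const_mul]; congr 1; ext ξ; ring
  have e2 : (∫ ξ : ℝ, Real.cos (a * ξ) * a * ((1 + ξ ^ 2) ^ (n + 1))⁻¹) =
      a * ∫ ξ : ℝ, Real.cos (a * ξ) / (1 + ξ ^ 2) ^ (n + 1) := by
    rw [← integral_const_mul]; congr 1; ext ξ; ring
  rw [e1, e2] at ibp
  have : (2 * ((n:ℝ) + 1)) ≠ 0 := by positivity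
  generalize (∫ ξ : ℝ, -(Real.sin (a * ξ)) * (ξ / (1 + ξ ^ 2) ^ (n + 2))) = X at ibp ⊢
  generalize (∫ ξ : ℝ, Real.cos (a * ξ) / (1 + ξ ^ 2) ^ (n + 1)) = Y at ibp ⊢
  field_simp
  linarith

open MeasureTheory Filter Topology in
theorem aux_zero (n : ℕ) :
    (∫ ξ : ℝ, ((1 + ξ ^ 2) ^ (n + 2))⁻¹ : ℝ) =
      (2 * (n : ℝ) + 1) / (2 * n + 2) * ∫ ξ : ℝ, ((1 + ξ ^ 2) ^ (n + 1))⁻¹ := by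
  have hd : ∀ ξ : ℝ, HasDerivAt (fun ξ : ℝ => ξ * ((1 + ξ ^ 2) ^ (n + 1))⁻¹)
      ((2 * n + 2) * ((1 + ξ ^ 2) ^ (n + 2))⁻¹ - (2 * n + 1) * ((1 + ξ ^ 2) ^ (n + 1))⁻¹) ξ := by
    intro ξ
    refine ((hasDerivAt_id ξ).mul (aux_hd n ξ)).congr_deriv ?_
    simp only [id]
    field_simp
    ring
  have hb : ∀ ξ : ℝ, |ξ * ((1 + ξ ^ 2) ^ (n + 1))⁻¹| ≤ |ξ⁻¹| := by
    intro ξ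
    rcases eq_or_ne ξ 0 with rfl | h
    · simp
    have h0 : 0 < |ξ| := abs_pos.mpr h
    rw [abs_mul, abs_inv, abs_inv, abs_of_pos (show (0:ℝ) < (1 + ξ ^ 2) ^ (n + 1) by positivity)]
    have h1 : ξ ^ 2 ≤ (1 + ξ ^ 2) ^ (n + 1) :=
      le_trans (by linarith) (le_self_pow₀ (by nlinarith [sq_nonneg ξ]) (by omega))
    field_simp
    simpa using h1
  have t1 : Tendsto (fun ξ : ℝ => ξ * ((1 + ξ ^ 2) ^ (n + 1))⁻¹) atTop (𝓝 0) :=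
    squeeze_zero_norm hb (by simpa using (tendsto_inv_atTop_zero (𝕜 := ℝ)).abs)
  have t2 : Tendsto (fun ξ : ℝ => ξ * ((1 + ξ ^ 2) ^ (n + 1))⁻¹) atBot (𝓝 0) :=
    squeeze_zero_norm hb (by simpa using (tendsto_inv_atBot_zero (𝕜 := ℝ)).abs)
  have i1 := (aux_int (n + 1)).const_mul (2 * n + 2 : ℝ)
  have i2 := (aux_int n).const_mul (2 * n + 1 : ℝ)
  have h := integral_of_hasDerivAt_of_tendsto hd (i1.sub i2) t2 t1
  rw [integral_sub i1 i2, integral_const_mul, integral_const_mul] at h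
  have : (2 * (n:ℝ) + 2) ≠ 0 := by positivity
  rw [show n + 1 + 1 = n + 2 from rfl] at h
  generalize (∫ ξ : ℝ, ((1 + ξ ^ 2) ^ (n + 2))⁻¹) = X at h ⊢
  generalize (∫ ξ : ℝ, ((1 + ξ ^ 2) ^ (n + 1))⁻¹) = Y at h ⊢
  field_simp
  linarith

/-- Bessel polynomial coefficients -/
noncomputable def bc (n k : ℕ) : ℝ :=
  (((n + k)! : ℝ) / ((k ! : ℝ) * ((n - k)! : ℝ))) * ((2 : ℝ) ^ k)⁻¹

noncomputable def bth (n : ℕ) (x : ℝ) : ℝ := ∑ k ∈ Finset.range (n + 1), bc n k * x ^ (n - k)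

theorem bc_rec (n k : ℕ) (h : k + 1 ≤ n) :
    bc (n + 1) (k + 1) - bc n (k + 1) = bc (n + 1) k * ((n + 1 - k : ℕ) : ℝ) := by
  obtain ⟨m, rfl⟩ := Nat.exists_eq_add_of_le h
  unfold bc
  rw [show k + 1 + m + 1 - (k + 1) = m + 1 by omega, show k + 1 + m - (k + 1) = m by omega,
    show k + 1 + m + 1 - k = m + 2 by omega,
    show k + 1 + m + 1 + (k + 1) = (2 * k + m + 2) + 1 by ring,
    show k + 1 + m + (k + 1) = 2 * k + m + 2 by ring,
    show k + 1 + m + 1 + k = 2 * k + m + 2 by ring]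
  rw [Nat.factorial_succ (2 * k + m + 2), Nat.factorial_succ k, Nat.factorial_succ (m + 1),
    Nat.factorial_succ m]
  have := Nat.factorial_pos (2 * k + m + 2)
  push_cast
  have h1 : (k ! : ℝ) ≠ 0 := by positivity
  have h2 : (m ! : ℝ) ≠ 0 := by positivity
  field_simp
  ring

theorem bc_last (n : ℕ) : bc (n + 1) (n + 1) = bc (n + 1) n := by
  unfold bc
  rw [show n + 1 - (n + 1) = 0 by omega, show n + 1 - n = 1 by omega,
    show n + 1 + (n + 1) = (2 * n + 1) + 1 by ring, show n + 1 + n = 2 * n + 1 by ring,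
    Nat.factorial_succ (2 * n + 1), Nat.factorial_succ n]
  push_cast
  have h1 : (n ! : ℝ) ≠ 0 := by positivity
  simp
  field_simp
  ring

theorem bc_zero (n : ℕ) : bc n 0 = 1 := by
  have h1 : (n ! : ℝ) ≠ 0 := by positivity
  simp [bc, h1]

theorem bth_hd (n : ℕ) (x : ℝ) : HasDerivAt (bth (n + 1)) (bth (n + 1) x - x * bth n x) x := by
  have h : HasDerivAt (fun x => ∑ k ∈ Finset.range (n + 1 + 1), bc (n + 1) k * x ^ (n + 1 - k))
      (∑ k ∈ Finset.range (n + 1 + 1),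
        bc (n + 1) k * (((n + 1 - k : ℕ) : ℝ) * x ^ (n + 1 - k - 1))) x :=
    HasDerivAt.fun_sum fun k _ => (hasDerivAt_pow (n + 1 - k) x).const_mul _
  refine HasDerivAt.congr_deriv h ?_
  unfold bth
  rw [Finset.sum_range_succ (n := n + 1), Finset.sum_range_succ (n := n),
    Finset.sum_range_succ' (n := n + 1), Finset.sum_range_succ (n := n),
    Finset.sum_range_succ' (n := n), bc_last, bc_zero, bc_zero, mul_add, Finset.mul_sum]
  have : ∑ k ∈ Finset.range n, bc (n + 1) k * (((n + 1 - k : ℕ) : ℝ) * x ^ (n + 1 - k - 1)) =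
      ∑ k ∈ Finset.range n, bc (n + 1) (k + 1) * x ^ (n + 1 - (k + 1)) -
      ∑ k ∈ Finset.range n, x * (bc n (k + 1) * x ^ (n - (k + 1))) := by
    rw [← Finset.sum_sub_distrib]
    refine Finset.sum_congr rfl fun k hk => ?_
    have hk := Finset.mem_range.mp hk
    rw [← mul_assoc, ← bc_rec n k hk, show n + 1 - k - 1 = (n - (k + 1)) + 1 by omega,
      show n + 1 - (k + 1) = (n - (k + 1)) + 1 by omega]
    ring
  rw [this]
  simp
  ring

theorem bth_zero (n : ℕ) : bth n 0 = bc n n := by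
  unfold bth
  rw [Finset.sum_range_succ, Finset.sum_eq_zero]
  · simp
  · intro k hk
    have hk := Finset.mem_range.mp hk
    rw [zero_pow (by omega), mul_zero]

theorem bc_diag (n : ℕ) : bc (n + 1) (n + 1) = (2 * n + 1) * bc n n := by
  unfold bc
  rw [show n + 1 + (n + 1) = (n + n + 1) + 1 by ring,
    Nat.factorial_succ (n + n + 1), Nat.factorial_succ (n + n), Nat.factorial_succ n]
  push_cast
  have h1 : (n ! : ℝ) ≠ 0 := by positivity
  simp
  field_simp
  ring

theorem aux_main (n : ℕ) : ∀ a : ℝ, 0 ≤ a →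
    (∫ ξ : ℝ, Real.cos (a * ξ) / (1 + ξ ^ 2) ^ (n + 1)) =
      2 * Real.pi / (2 ^ (n + 1) * n !) * (Real.exp (-a) * bth n a) := by
  induction n with
  | zero =>
    intro a ha
    simp only [zero_add, pow_one]
    rw [aux_base a ha]
    simp [bth, bc]
  | succ n ih =>
    intro a ha
    have hfac : (n ! : ℝ) ≠ 0 := by positivity
    have h0 := ih 0 le_rfl
    let D : ℝ → ℝ := fun a => (∫ ξ : ℝ, Real.cos (a * ξ) / (1 + ξ ^ 2) ^ (n + 2)) -
      2 * Real.pi / (2 ^ (n + 2) * (n + 1)!) * (Real.exp (-a) * bth (n + 1) a)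
    have hD : ∀ x : ℝ, 0 ≤ x → HasDerivAt D 0 x := by
      intro x hx
      have h1 := aux_deriv n x
      rw [ih x hx] at h1
      have h2 := (((hasDerivAt_neg x).exp.mul (bth_hd n x)).const_mul
        (2 * Real.pi / (2 ^ (n + 2) * (n + 1)!)))
      refine (h1.sub h2).congr_deriv ?_
      rw [Nat.factorial_succ]
      push_cast
      field_simp
      ring
    have hc := constant_of_has_deriv_right_zero (f := D) (a := 0) (b := a)
      (fun x hx => (hD x hx.1).continuousAt.continuousWithinAt)
      (fun x hx => (hD x hx.1).hasDerivWithinAt) a ⟨ha, le_rfl⟩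
    have hD0 : D 0 = 0 := by
      simp only [D, zero_mul, Real.cos_zero, one_div, neg_zero, Real.exp_zero, one_mul] at h0 ⊢
      rw [aux_zero, h0, bth_zero, bth_zero, bc_diag, Nat.factorial_succ]
      push_cast
      field_simp
      ring
    rw [hD0] at hc
    exact sub_eq_zero.mp hc

/-- The one-dimensional inverse Fourier transform of `(1+ξ²)^{-A}`:
`(1/(2π)) ∫ cos(aξ) (1+ξ²)^{-A} dξ
  = (e^{-a}/(2^A (A-1)!)) ∑_{k=0}^{A-1} ((A+k-1)!/(k!(A-k-1)!)) 2^{-k} a^{A-1-k}`. -/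
theorem stmt_7 (A : ℕ) (hA : 1 ≤ A) (a : ℝ) (ha : 0 ≤ a) :
    (1 / (2 * Real.pi)) * ∫ ξ : ℝ, Real.cos (a * ξ) / (1 + ξ ^ 2) ^ A
      = (Real.exp (-a) / (2 ^ A * (A - 1)!)) *
        ∑ k ∈ Finset.range A,
          (((A + k - 1)! : ℝ) / ((k ! : ℝ) * ((A - k - 1)! : ℝ))) *
            ((2 : ℝ) ^ k)⁻¹ * a ^ (A - 1 - k) := by
  obtain ⟨n, rfl⟩ : ∃ n, A = n + 1 := ⟨A - 1, by omega⟩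
  rw [aux_main n a ha]
  have : ∑ k ∈ Finset.range (n + 1),
          (((n + 1 + k - 1)! : ℝ) / ((k ! : ℝ) * ((n + 1 - k - 1)! : ℝ))) *
            ((2 : ℝ) ^ k)⁻¹ * a ^ (n + 1 - 1 - k) = bth n a := by
    unfold bth bc
    refine Finset.sum_congr rfl fun k hk => ?_
    rw [show n + 1 + k - 1 = n + k by omega, show n + 1 - k - 1 = n - k by omega,
      Nat.add_sub_cancel]
  rw [this, Nat.add_sub_cancel]
  have := Real.pi_pos
  have hfac : (n ! : ℝ) ≠ 0 := by positivity
  field_simp
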